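/- The map Ψ from rooted trees to multi-indice monomials intertwines grafting with the product of the free Novikov algebra: for all rooted trees t_1, t_2 ∈ T, the linear extension of Ψ satisfies Ψ(t_1 ↷ t_2) = Ψ(t_1) · D(Ψ(t_2)) in ℝ[X_0, X_1, …]. -/

import Mathlib

open MvPolynomial

/-- Rooted trees: a tree is a (possibly empty) list of subtrees. -/
inductive T : Type
  | node : List T → T

/-- The derivation `D` with `D X_k = X_{k+1}`. -/
noncomputable def Dop (p : MvPolynomial ℕ ℝ) : MvPolynomial ℕ ℝ :=
  ∑ᶠ k : ℕ, X (k + 1) * pderiv k p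

/-- `Ψ(node [t_1, …, t_n]) = X_n ∏_i Ψ(t_i)`. -/
noncomputable def Psi : T → MvPolynomial ℕ ℝ
  | .node l => X l.length * (l.attach.map fun s => Psi s.1).prod
termination_by t => sizeOf t
decreasing_by
  have := List.sizeOf_lt_of_mem s.2
  simp only [T.node.sizeOf_spec]
  omega

mutual
  /-- Grafting `t ↷ s` in the free vector space on trees:
  `t ↷ node [s_1,…,s_n] = node (t :: [s_1,…,s_n]) + ∑_i node [s_1,…,(t ↷ s_i),…,s_n]`,
  the `i`-th slot being extended linearly. -/
  noncomputable def graft (t : T) : T → (T →₀ ℝ)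
    | .node l => Finsupp.single (.node (t :: l)) 1 + graftList t [] l
  termination_by s => sizeOf s

  /-- Helper: the sum over positions in the list `post`, with `pre` the already-visited
  prefix, of the linear extension of grafting into that slot. -/
  noncomputable def graftList (t : T) : List T → List T → (T →₀ ℝ)
    | _, [] => 0
    | pre, s :: post =>
        ((graft t s).sum fun s' c => Finsupp.single (T.node (pre ++ s' :: post)) c)
          + graftList t (pre ++ [s]) post
  termination_by _ post => sizeOf post
end

/-- The linear extension of `Ψ` to the free vector space on trees. -/
noncomputable def PsiL (c : T →₀ ℝ) : MvPolynomial ℕ ℝ :=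
  c.sum fun s r => r • Psi s

lemma Psi_node (l : List T) : Psi (.node l) = X l.length * (l.map Psi).prod := by
  rw [Psi, List.attach_map_val]

lemma finite_support_X_mul_pderiv (p : MvPolynomial ℕ ℝ) :
    (Function.support fun k : ℕ => X (k + 1) * pderiv k p).Finite := by
  refine p.vars.finite_toSet.subset fun k hk => ?_
  by_contra h
  exact hk (by simp [pderiv_eq_zero_of_notMem_vars (by simpa using h)])

lemma Dop_mul (p q : MvPolynomial ℕ ℝ) : Dop (p * q) = p * Dop q + q * Dop p := by
  have hp := finite_support_X_mul_pderiv p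
  have hq := finite_support_X_mul_pderiv q
  unfold Dop
  rw [mul_finsum' _ _ hq, mul_finsum' _ _ hp, ← finsum_add_distrib]
  · refine finsum_congr fun k => ?_
    rw [Derivation.leibniz, smul_eq_mul, smul_eq_mul]
    ring
  · exact hq.subset (Function.support_mul_subset_right (fun _ => p) _)
  · exact hp.subset (Function.support_mul_subset_right (fun _ => q) _)

lemma Dop_one : Dop 1 = 0 := by
  simp [Dop]

lemma Dop_X (n : ℕ) : Dop (X n) = X (n + 1) := by
  unfold Dop
  rw [finsum_eq_single _ n fun k hk => by simp [pderiv_X_of_ne hk.symm]]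
  simp

lemma PsiL_add (a b : T →₀ ℝ) : PsiL (a + b) = PsiL a + PsiL b :=
  Finsupp.sum_add_index' (fun _ => zero_smul _ _) fun _ _ _ => add_smul _ _ _

lemma PsiL_single (s : T) (r : ℝ) : PsiL (Finsupp.single s r) = r • Psi s :=
  Finsupp.sum_single_index (zero_smul _ _)

/-- Extending a map of trees linearly, when it multiplies `Psi` by a fixed polynomial,
multiplies `PsiL` by that polynomial. -/
lemma PsiL_sum_single (f : T → T) (q : MvPolynomial ℕ ℝ) (hf : ∀ s, Psi (f s) = q * Psi s)
    (c : T →₀ ℝ) : PsiL (c.sum fun s r => Finsupp.single (f s) r) = q * PsiL c := by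
  change PsiL (c.mapDomain f) = _
  unfold PsiL
  rw [Finsupp.sum_mapDomain_index (h := fun s (r : ℝ) => r • Psi s)
      (fun _ => zero_smul _ _) fun _ _ _ => add_smul _ _ _,
    Finsupp.mul_sum]
  simp only [hf, mul_smul_comm]

lemma PsiL_graftList (t : T) (pre post : List T)
    (h : ∀ s ∈ post, PsiL (graft t s) = Psi t * Dop (Psi s)) :
    PsiL (graftList t pre post) =
      X (pre.length + post.length) * (pre.map Psi).prod * Psi t * Dop (post.map Psi).prod := by
  induction post generalizing pre with
  | nil => simp [graftList, PsiL, Dop_one]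
  | cons s post ih =>
    rw [graftList, PsiL_add, ih _ fun u hu => h u (List.mem_cons_of_mem _ hu),
      PsiL_sum_single _ (X (pre.length + (post.length + 1)) * (pre.map Psi).prod *
        (post.map Psi).prod), h s List.mem_cons_self]
    · simp only [List.map_cons, List.map_append, List.map_nil, List.prod_cons, List.prod_append,
        List.prod_nil, List.length_append, List.length_cons, List.length_nil, Dop_mul,
        add_comm post.length, add_assoc, zero_add]
      ring
    · intro u
      simp only [Psi_node, List.map_cons, List.map_append, List.prod_cons, List.prod_append,
        List.length_append, List.length_cons]
      ring

/-- `Ψ` intertwines grafting of rooted trees with the product `u ▷ v = u · D v`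
of the free Novikov algebra: `Ψ(t₁ ↷ t₂) = Ψ(t₁) · D(Ψ(t₂))`. -/
theorem Psi_graft (t₁ t₂ : T) :
    PsiL (graft t₁ t₂) = Psi t₁ * Dop (Psi t₂) := by
  match t₂ with
  | .node l =>
    rw [graft, PsiL_add, PsiL_single, PsiL_graftList _ _ _ fun s _ => Psi_graft t₁ s,
      Psi_node, Psi_node, Dop_mul, Dop_X]
    simp only [List.map_cons, List.prod_cons, List.length_cons, List.length_nil, List.map_nil,
      List.prod_nil, one_smul, zero_add]
    ring
termination_by t₂
decreasing_by
  have := List.sizeOf_lt_of_mem ‹s ∈ l›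
  simp only [T.node.sizeOf_spec]
  omega
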